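/- (Step (3.5) in the proof of Theorem 3.2) Let F̄ be the fractal triple described below, let E be an irreducible Dirichlet form on V⁰ and r ∈ (0,∞)^{20} with Λ_r(E) = E. Then r̄ := max{ min(r_{2h+1}, r_{2h+2}) : h = 0,…,9 } satisfies r̄ ≤ 2. -/

import Mathlib

/-- A Dirichlet form on a finite set `V`, invariant with respect to an additive
constant: a functional of the form `E u = ∑_{{p,q} ⊆ V, p ≠ q} c_{p,q} (u p - u q)²`
with nonnegative coefficients (encoded via a symmetric nonnegative coefficient
matrix, summing over ordered pairs; the diagonal terms vanish). -/
def IsDirichletForm {V : Type*} [Fintype V] (E : (V → ℝ) → ℝ) : Prop :=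
  ∃ c : V → V → ℝ, (∀ p q, 0 ≤ c p q) ∧ (∀ p q, c p q = c q p) ∧
    ∀ u : V → ℝ, E u = ∑ p, ∑ q, c p q * (u p - u q) ^ 2

/-- An irreducible Dirichlet form: moreover `E u = 0` iff `u` is constant. -/
def IsIrreducibleDirichletForm {V : Type*} [Fintype V] (E : (V → ℝ) → ℝ) : Prop :=
  IsDirichletForm E ∧ ∀ u : V → ℝ, E u = 0 ↔ ∀ p q, u p = u q

/-- The fractal triple `F̄` of Section 3, with `N = k = 20`. Points and maps are
indexed by `ZMod 20` (indices read modulo 20). `V⁰` is encoded by the injective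
family `P : ZMod 20 → V1` of points of the finite set `V¹ = V1`, and the
one-to-one maps `ψ i : V⁰ → V¹` are encoded as injective maps `ZMod 20 → V1`
covering `V¹`, with `ψ j (P j) = P j` and `P j ∉ ψ i (V⁰)` for `i ≠ j`.
The cells `V_i = ψ i (V⁰)` satisfy `V_i ∩ V_{i'} = ∅` if `i' ∉ {i-1, i, i+1}`,
and `V_i ∩ V_{i+1} = {Q̄_i}` where `Q̄_i = ψ i (P (i+1)) = ψ (i+1) (P i)` for `i`
odd and `Q̄_i = ψ i (P (i+9)) = ψ (i+1) (P (i-8))` for `i` even. -/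
structure ExampleFractal (V1 : Type*) [Fintype V1] where
  P : ZMod 20 → V1
  P_inj : Function.Injective P
  ψ : ZMod 20 → ZMod 20 → V1
  ψ_inj : ∀ i, Function.Injective (ψ i)
  cover : ∀ y : V1, ∃ i j, ψ i j = y
  fixed : ∀ j, ψ j j = P j
  sep : ∀ i j, i ≠ j → P j ∉ Set.range (ψ i)
  disj : ∀ i i' : ZMod 20, i' ≠ i - 1 → i' ≠ i → i' ≠ i + 1 →
    Set.range (ψ i) ∩ Set.range (ψ i') = ∅
  inter_odd : ∀ i : ZMod 20, i.val % 2 = 1 →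
    ψ i (i + 1) = ψ (i + 1) i ∧
    Set.range (ψ i) ∩ Set.range (ψ (i + 1)) = {ψ i (i + 1)}
  inter_even : ∀ i : ZMod 20, i.val % 2 = 0 →
    ψ i (i + 9) = ψ (i + 1) (i - 8) ∧
    Set.range (ψ i) ∩ Set.range (ψ (i + 1)) = {ψ i (i + 9)}

variable {V1 : Type*} [Fintype V1]

/-- `S_{1,r}(E)(v) = ∑ i, r i * E (v ∘ ψ i)`. -/
noncomputable def S1r (F : ExampleFractal V1) (r : ZMod 20 → ℝ)
    (E : (ZMod 20 → ℝ) → ℝ) (v : V1 → ℝ) : ℝ :=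
  ∑ i, r i * E (fun j => v (F.ψ i j))

/-- The renormalization operator:
`Λ_r(E)(u) = inf { S_{1,r}(E)(v) : v : V1 → ℝ, v = u on V⁰ }`. -/
noncomputable def Lam (F : ExampleFractal V1) (r : ZMod 20 → ℝ)
    (E : (ZMod 20 → ℝ) → ℝ) (u : ZMod 20 → ℝ) : ℝ :=
  sInf {x : ℝ | ∃ v : V1 → ℝ, (∀ j, v (F.P j) = u j) ∧ S1r F r E v = x}

theorem IsDirichletForm.nonneg {V : Type*} [Fintype V] {E : (V → ℝ) → ℝ}
    (hE : IsDirichletForm E) (u : V → ℝ) : 0 ≤ E u := by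
  obtain ⟨c, hc, -, h⟩ := hE
  rw [h]
  exact Finset.sum_nonneg fun p _ => Finset.sum_nonneg fun q _ =>
    mul_nonneg (hc p q) (sq_nonneg _)

/-- Effective resistances of an irreducible Dirichlet form are finite. -/
theorem IsIrreducibleDirichletForm.exists_sq_sub_le {V : Type*} [Fintype V]
    {E : (V → ℝ) → ℝ} (hE : IsIrreducibleDirichletForm E) (p q : V) :
    ∃ K : ℝ, ∀ u : V → ℝ, (u p - u q) ^ 2 ≤ K * E u := by
  classical
  obtain ⟨⟨c, hc, hsymm, h⟩, hconst⟩ := hE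
  have hterm : ∀ (u : V → ℝ) (a b : V), c a b * (u a - u b) ^ 2 ≤ E u := by
    intro u a b
    rw [h]
    have hpos : ∀ x y, 0 ≤ c x y * (u x - u y) ^ 2 := fun x y =>
      mul_nonneg (hc x y) (sq_nonneg _)
    calc c a b * (u a - u b) ^ 2
        ≤ ∑ y, c a y * (u a - u y) ^ 2 :=
          Finset.single_le_sum (f := fun y => c a y * (u a - u y) ^ 2)
            (fun y _ => hpos a y) (Finset.mem_univ b)
      _ ≤ _ := Finset.single_le_sum (f := fun x => ∑ y, c x y * (u x - u y) ^ 2)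
            (fun x _ => Finset.sum_nonneg fun y _ => hpos x y) (Finset.mem_univ a)
  let A : V → Prop := fun x => ∃ K : ℝ, ∀ u : V → ℝ, (u p - u x) ^ 2 ≤ K * E u
  have hstep : ∀ a b, A a → 0 < c a b → A b := by
    rintro a b ⟨K, hK⟩ hab
    refine ⟨2 * K + 2 / c a b, fun u => ?_⟩
    have h1 : (u a - u b) ^ 2 ≤ E u / c a b := by
      rw [le_div_iff₀ hab, mul_comm]
      exact hterm u a b
    have h2 := hK u
    have h3 : (2 * K + 2 / c a b) * E u = 2 * (K * E u) + 2 * (E u / c a b) := by ring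
    rw [h3]
    nlinarith [sq_nonneg ((u p - u a) - (u a - u b))]
  have hzero : E (fun x => if A x then 1 else 0) = 0 := by
    rw [h]
    refine Finset.sum_eq_zero fun a _ => Finset.sum_eq_zero fun b _ => ?_
    rcases (hc a b).eq_or_lt with h0 | hab
    · simp [← h0]
    · have : A a ↔ A b :=
        ⟨fun ha => hstep a b ha hab, fun hb => hstep b a hb (hsymm a b ▸ hab)⟩
      simp [this]
  have hpA : A p := ⟨0, fun u => by simp⟩
  by_contra hq
  have := (hconst _).1 hzero p q
  rw [if_pos hpA, if_neg hq] at this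
  exact one_ne_zero this

theorem sq_sub_le_S1r (F : ExampleFractal V1) {E : (ZMod 20 → ℝ) → ℝ}
    (hE : IsDirichletForm E) {r : ZMod 20 → ℝ} (hr : ∀ i, 0 < r i)
    {i : ZMod 20} (hi : i.val % 2 = 1) {m K : ℝ} (hm : 0 < m) (hm₁ : m ≤ r i)
    (hm₂ : m ≤ r (i + 1)) (hK₀ : 0 ≤ K)
    (hK : ∀ u, (u i - u (i + 1)) ^ 2 ≤ K * E u) (v : V1 → ℝ) :
    (v (F.P i) - v (F.P (i + 1))) ^ 2 ≤ 2 / m * K * S1r F r E v := by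
  have hnn := hE.nonneg
  have h1 := hK fun j => v (F.ψ i j)
  have h2 := hK fun j => v (F.ψ (i + 1) j)
  simp only [F.fixed, ← (F.inter_odd i hi).1] at h1 h2
  set E₁ := E fun j => v (F.ψ i j) with hE₁
  set E₂ := E fun j => v (F.ψ (i + 1) j) with hE₂
  have hS : r i * E₁ + r (i + 1) * E₂ ≤ S1r F r E v := by
    have hne : i ≠ i + 1 := (add_ne_left.2 (by decide)).symm
    rw [hE₁, hE₂, S1r, ← Finset.sum_pair (f := fun k => r k * E fun j => v (F.ψ k j)) hne]
    exact Finset.sum_le_sum_of_subset_of_nonneg (Finset.subset_univ _)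
      fun k _ _ => mul_nonneg (hr k).le (hnn _)
  have hmS : m * (E₁ + E₂) ≤ S1r F r E v := by
    nlinarith [mul_le_mul_of_nonneg_right hm₁ (hnn fun j => v (F.ψ i j)),
      mul_le_mul_of_nonneg_right hm₂ (hnn fun j => v (F.ψ (i + 1) j))]
  have hsum : E₁ + E₂ ≤ S1r F r E v / m := by rwa [le_div_iff₀ hm, mul_comm]
  calc (v (F.P i) - v (F.P (i + 1))) ^ 2
      ≤ 2 * (K * (E₁ + E₂)) := by
        nlinarith [sq_nonneg ((v (F.P i) - v (F.ψ i (i + 1)))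
          - (v (F.ψ i (i + 1)) - v (F.P (i + 1))))]
    _ ≤ 2 * (K * (S1r F r E v / m)) := by gcongr
    _ = 2 / m * K * S1r F r E v := by ring

theorem sq_sub_le_of_Lam_eq (F : ExampleFractal V1) {E : (ZMod 20 → ℝ) → ℝ}
    (hE : IsDirichletForm E) {r : ZMod 20 → ℝ} (hr : ∀ i, 0 < r i)
    (heig : Lam F r E = E) {i : ZMod 20} (hi : i.val % 2 = 1) {m K : ℝ} (hm : 0 < m)
    (hm₁ : m ≤ r i) (hm₂ : m ≤ r (i + 1)) (hK₀ : 0 < K)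
    (hK : ∀ u, (u i - u (i + 1)) ^ 2 ≤ K * E u) (u : ZMod 20 → ℝ) :
    (u i - u (i + 1)) ^ 2 ≤ 2 / m * K * E u := by
  have hpos : 0 < 2 / m * K := by positivity
  rw [← div_le_iff₀' hpos, ← congrFun heig u, Lam]
  refine le_csInf ⟨_, Function.extend F.P u 0, fun j => F.P_inj.extend_apply u 0 j, rfl⟩ ?_
  rintro x ⟨v, hv, rfl⟩
  rw [div_le_iff₀' hpos, ← hv i, ← hv (i + 1)]
  exact sq_sub_le_S1r F hE hr hi hm hm₁ hm₂ hK₀.le hK v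

theorem min_le_two_of_Lam_eq (F : ExampleFractal V1) {E : (ZMod 20 → ℝ) → ℝ}
    (hE : IsIrreducibleDirichletForm E) {r : ZMod 20 → ℝ} (hr : ∀ i, 0 < r i)
    (heig : Lam F r E = E) {i : ZMod 20} (hi : i.val % 2 = 1) :
    min (r i) (r (i + 1)) ≤ 2 := by
  by_contra! hlt
  set m := min (r i) (r (i + 1))
  have hm : 0 < m := two_pos.trans hlt
  obtain ⟨K₀, hK₀⟩ := hE.exists_sq_sub_le i (i + 1)
  obtain ⟨K, hKpos, hK⟩ : ∃ K : ℝ, 0 < K ∧ ∀ u, (u i - u (i + 1)) ^ 2 ≤ K * E u :=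
    ⟨max K₀ 1, by positivity, fun u => (hK₀ u).trans
      (mul_le_mul_of_nonneg_right (le_max_left _ _) (hE.1.nonneg u))⟩
  have hiter : ∀ (n : ℕ) (u : ZMod 20 → ℝ),
      (u i - u (i + 1)) ^ 2 ≤ (2 / m) ^ n * K * E u := by
    intro n
    induction n with
    | zero => simpa using hK
    | succ n ih =>
      intro u
      rw [pow_succ' (2 / m), mul_assoc (2 / m)]
      exact sq_sub_le_of_Lam_eq F hE.1 hr heig hi hm (min_le_left _ _) (min_le_right _ _)
        (by positivity) ih u
  have hlim : Filter.Tendsto (fun n : ℕ => (2 / m) ^ n * K * E (Pi.single i 1))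
      Filter.atTop (nhds (0 * K * E (Pi.single i 1))) :=
    ((tendsto_pow_atTop_nhds_zero_of_lt_one (by positivity)
      ((div_lt_one hm).2 hlt)).mul_const _).mul_const _
  have := ge_of_tendsto' hlim fun n => hiter n (Pi.single i 1)
  have hne : i + 1 ≠ i := add_ne_left.2 (by decide)
  norm_num [Pi.single_eq_of_ne hne] at this

/-- Step (3.5) in the proof of Theorem 3.2: if `Λ_r(E) = E`, then
`r̄ := max { min (r (2h+1)) (r (2h+2)) : h = 0, …, 9 } ≤ 2`. -/
theorem rbar_le_two (F : ExampleFractal V1)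
    (E : (ZMod 20 → ℝ) → ℝ) (hE : IsIrreducibleDirichletForm E)
    (r : ZMod 20 → ℝ) (hr : ∀ i, 0 < r i)
    (heig : Lam F r E = E) :
    (Finset.range 10).sup' (by norm_num)
      (fun h => min (r ((2 * h + 1 : ℕ) : ZMod 20)) (r ((2 * h + 2 : ℕ) : ZMod 20)))
      ≤ 2 := by
  refine Finset.sup'_le _ _ fun h hh => ?_
  have hodd : ((2 * h + 1 : ℕ) : ZMod 20).val % 2 = 1 := by
    rw [ZMod.val_natCast]
    omega
  have hsucc : ((2 * h + 2 : ℕ) : ZMod 20) = ((2 * h + 1 : ℕ) : ZMod 20) + 1 := by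
    push_cast
    ring
  rw [hsucc]
  exact min_le_two_of_Lam_eq F hE hr heig hodd
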